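/- Let L ≥ 1 be an integer and a ≥ 0 a real number, and for u, v ∈ (0,1] define F(u,v) = (1/(L·u·v) + (L−1)/(L·v) + a)⁻¹. Then: (i) F is nondecreasing in u for each fixed v, and nondecreasing in v for each fixed u (so the asymptotic SINR decreases as either the access-point or user oscillator phase variance increases); and (ii) for all u, v ∈ (0,1] with v ≤ u, F(u,v) ≤ F(v,u) (so the user-side oscillator degradation has a larger effect on the SINR than the same access-point-side degradation). -/

import Mathlib

/-- **Monotonicity of the asymptotic SINR in the oscillator-phase attenuation factors.**
For `L ≥ 1`, `a ≥ 0` and `F u v = (1/(L·u·v) + (L−1)/(L·v) + a)⁻¹` with `u, v ∈ (0,1]`: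
(i) `F` is nondecreasing in `u` and in `v` (the SINR decreases as either the access-point
or the user oscillator phase variance increases); and (ii) if `v ≤ u` then
`F u v ≤ F v u` (the user-side oscillator degradation has a larger effect on the SINR
than the same access-point-side degradation). -/
theorem asymptotic_sinr_monotone (L : ℕ) (hL : 1 ≤ L) (a : ℝ) (ha : 0 ≤ a) :
    (∀ v ∈ Set.Ioc (0 : ℝ) 1, ∀ u₁ ∈ Set.Ioc (0 : ℝ) 1, ∀ u₂ ∈ Set.Ioc (0 : ℝ) 1,
      u₁ ≤ u₂ →
        (1 / ((L : ℝ) * u₁ * v) + ((L : ℝ) - 1) / ((L : ℝ) * v) + a)⁻¹ ≤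
        (1 / ((L : ℝ) * u₂ * v) + ((L : ℝ) - 1) / ((L : ℝ) * v) + a)⁻¹) ∧
    (∀ u ∈ Set.Ioc (0 : ℝ) 1, ∀ v₁ ∈ Set.Ioc (0 : ℝ) 1, ∀ v₂ ∈ Set.Ioc (0 : ℝ) 1,
      v₁ ≤ v₂ →
        (1 / ((L : ℝ) * u * v₁) + ((L : ℝ) - 1) / ((L : ℝ) * v₁) + a)⁻¹ ≤
        (1 / ((L : ℝ) * u * v₂) + ((L : ℝ) - 1) / ((L : ℝ) * v₂) + a)⁻¹) ∧
    (∀ u ∈ Set.Ioc (0 : ℝ) 1, ∀ v ∈ Set.Ioc (0 : ℝ) 1, v ≤ u →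
        (1 / ((L : ℝ) * u * v) + ((L : ℝ) - 1) / ((L : ℝ) * v) + a)⁻¹ ≤
        (1 / ((L : ℝ) * v * u) + ((L : ℝ) - 1) / ((L : ℝ) * u) + a)⁻¹) := by
  have hL' : (1 : ℝ) ≤ L := by exact_mod_cast hL
  have hL₀ : (0 : ℝ) < L := by linarith
  have hL₁ : (0 : ℝ) ≤ L - 1 := by linarith
  have denom_pos {u v : ℝ} (hu : 0 < u) (hv : 0 < v) :
      0 < 1 / ((L : ℝ) * u * v) + ((L : ℝ) - 1) / ((L : ℝ) * v) + a := by positivity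
  refine ⟨?_, ?_, ?_⟩
  · rintro v ⟨hv, -⟩ u₁ ⟨hu₁, -⟩ u₂ ⟨hu₂, -⟩ h
    apply inv_anti₀ (denom_pos hu₂ hv)
    gcongr
  · rintro u ⟨hu, -⟩ v₁ ⟨hv₁, -⟩ v₂ ⟨hv₂, -⟩ h
    apply inv_anti₀ (denom_pos hu hv₂)
    gcongr
  · rintro u ⟨hu, -⟩ v ⟨hv, -⟩ h
    apply inv_anti₀ (denom_pos hv hu)
    rw [mul_right_comm (L : ℝ) v u]
    gcongr
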